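/- Let M be a PrA⁻-structure and let Mul : ℕ → M → M → M → Prop be the bounded-multiplication relation. Then for all n : ℕ and all x, y, z : M, Mul n x y z holds if and only if there exists a natural number m ≤ 2^(2^n) with y = m • one and z = m • x. -/

import Mathlib

/-- A model of the theory `PrA⁻`: an additive cancellative commutative monoid with
a distinguished element `one` satisfying the `PrA⁻` axioms. -/
structure PrAMinus (M : Type*) [AddCancelCommMonoid M] where
  one : M
  succ_ne_zero : ∀ x : M, x + one ≠ 0
  exists_pred : ∀ x : M, x ≠ 0 → ∃ y : M, x = y + one
  total : ∀ x y : M, (∃ z, x + z = y) ∨ (∃ z, y + z = x)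

/-- The strict order `x < y` of a `PrA⁻`-model: `∃ z ≠ 0, x + z = y`. -/
def PrAMinus.Lt {M : Type*} [AddCancelCommMonoid M] (_ : PrAMinus M) (x y : M) : Prop :=
  ∃ z : M, z ≠ 0 ∧ x + z = y

/-- The bounded-multiplication relation `Mul n x y z` of a `PrA⁻`-model. -/
def PrAMinus.Mul {M : Type*} [AddCancelCommMonoid M] (S : PrAMinus M) :
    ℕ → M → M → M → Prop
  | 0, x, y, z =>
      (y = 0 ∧ z = 0) ∨ (y = S.one ∧ z = x) ∨ (y = S.one + S.one ∧ z = x + x)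
  | n + 1, x, y, z =>
      ∃ y₁ y₂ y₃ y₄ z₁ z₂ z₄ : M,
        y = y₃ + y₄ ∧ S.Mul n y₁ y₂ y₃ ∧ S.Mul n x y₁ z₁ ∧ S.Mul n z₁ y₂ z₂ ∧
          S.Mul n x y₄ z₄ ∧ z = z₂ + z₄ ∧ S.Lt y₂ y₁

theorem PrAMinus.nsmul_one_lt_nsmul_one_iff {M : Type*} [AddCancelCommMonoid M]
    (S : PrAMinus M) (k j : ℕ) : S.Lt (k • S.one) (j • S.one) ↔ k < j := by
  constructor
  · rintro ⟨z, hz, h⟩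
    by_contra! hjk
    obtain ⟨d, rfl⟩ := Nat.exists_eq_add_of_le hjk
    obtain ⟨w, rfl⟩ := S.exists_pred z hz
    rw [add_nsmul, add_assoc, add_eq_left, ← add_assoc] at h
    exact S.succ_ne_zero _ h
  · intro h
    obtain ⟨d, rfl⟩ := Nat.exists_eq_add_of_lt h
    refine ⟨(d + 1) • S.one, ?_, ?_⟩
    · rw [succ_nsmul]
      exact S.succ_ne_zero _
    · rw [← add_nsmul, add_assoc]

theorem Nat.exists_mul_add_eq_of_le_sq {N m : ℕ} (hN : 0 < N) (hm : m ≤ N ^ 2) :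
    ∃ k l : ℕ, k < N ∧ l ≤ N ∧ m = k * N + l := by
  rcases hm.lt_or_eq with h | rfl
  · refine ⟨m / N, m % N, Nat.div_lt_of_lt_mul (by rwa [← sq]), (Nat.mod_lt _ hN).le, ?_⟩
    rw [mul_comm, Nat.div_add_mod]
  · obtain ⟨k, rfl⟩ := Nat.exists_eq_add_of_lt hN
    exact ⟨k, k + 1, by lia, by lia, by ring⟩

theorem prAMinus_mul_iff {M : Type*} [AddCancelCommMonoid M] (S : PrAMinus M)
    (n : ℕ) (x y z : M) :
    S.Mul n x y z ↔ ∃ m : ℕ, m ≤ 2 ^ (2 ^ n) ∧ y = m • S.one ∧ z = m • x := by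
  induction n generalizing x y z with
  | zero =>
    constructor
    · rintro (⟨rfl, rfl⟩ | ⟨rfl, rfl⟩ | ⟨rfl, rfl⟩)
      · exact ⟨0, by simp⟩
      · exact ⟨1, by simp⟩
      · exact ⟨2, by simp [two_nsmul]⟩
    · rintro ⟨m, hm, rfl, rfl⟩
      norm_num at hm
      interval_cases m <;> simp [PrAMinus.Mul, two_nsmul]
  | succ n ih =>
    simp only [PrAMinus.Mul, ih, pow_succ 2 n, pow_mul]
    constructor
    · rintro ⟨_, _, _, _, _, _, _, rfl, ⟨k, hk, rfl, rfl⟩, ⟨j, hj, rfl, rfl⟩,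
        ⟨k', -, hkk', rfl⟩, ⟨l, hl, rfl, rfl⟩, rfl, hlt⟩
      rw [S.nsmul_one_lt_nsmul_one_iff] at hlt
      have hk' : k' = k := by
        refine le_antisymm ?_ ?_ <;> by_contra! h <;>
          rw [← S.nsmul_one_lt_nsmul_one_iff, hkk', S.nsmul_one_lt_nsmul_one_iff] at h <;>
          exact h.false
      subst hk'
      refine ⟨k' * j + l, ?_, ?_, ?_⟩
      · nlinarith [Nat.mul_le_mul (Nat.succ_le_of_lt (hlt.trans_le hj)) hj]
      · rw [add_nsmul, mul_nsmul']
      · rw [add_nsmul, mul_nsmul']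
    · rintro ⟨m, hm, rfl, rfl⟩
      obtain ⟨k, l, hk, hl, rfl⟩ := Nat.exists_mul_add_eq_of_le_sq (by positivity) hm
      exact ⟨_, _, _, _, _, _, _, by rw [add_nsmul, mul_nsmul'], ⟨k, hk.le, rfl, rfl⟩,
        ⟨_, le_rfl, rfl, rfl⟩, ⟨k, hk.le, rfl, rfl⟩, ⟨l, hl, rfl, rfl⟩,
        by rw [add_nsmul, mul_nsmul'], (S.nsmul_one_lt_nsmul_one_iff _ _).2 hk⟩
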